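/- The set of regular points of a product of two Alexandrov spaces equals the product of the sets of regular points of the factors; consequently, the singular set of the product X₁ × X₂ equals (X₁ × X₂^sing) ∪ (X₁^sing × X₂). -/

import Mathlib

open Metric Set

/-- A (unit-speed) geodesic segment from `x` to `y` in a metric space: an isometric
parametrization of a shortest path. -/
structure GeodesicIn (X : Type*) [MetricSpace X] (x y : X) where
  path : ℝ → X
  source : path 0 = x
  target : path (dist x y) = y
  isom : ∀ ⦃s t : ℝ⦄, s ∈ Set.Icc (0 : ℝ) (dist x y) → t ∈ Set.Icc (0 : ℝ) (dist x y) →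
    dist (path s) (path t) = |s - t|

/-- The cosine of the comparison angle at the first vertex of a triangle with side
lengths `a = d(x₁,x₂)`, `b = d(x₁,x₃)`, `c = d(x₂,x₃)` in the model surface `M_K` of
constant curvature `K` (law of cosines in `M_K`). -/
noncomputable def modelCosAngle (K a b c : ℝ) : ℝ :=
  if 0 < K then
    (Real.cos (Real.sqrt K * c) - Real.cos (Real.sqrt K * a) * Real.cos (Real.sqrt K * b)) /
      (Real.sin (Real.sqrt K * a) * Real.sin (Real.sqrt K * b))
  else if K < 0 then
    (Real.cosh (Real.sqrt (-K) * a) * Real.cosh (Real.sqrt (-K) * b)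
        - Real.cosh (Real.sqrt (-K) * c)) /
      (Real.sinh (Real.sqrt (-K) * a) * Real.sinh (Real.sqrt (-K) * b))
  else (a ^ 2 + b ^ 2 - c ^ 2) / (2 * a * b)

/-- In the comparison triangle `Δx̄₁x̄₂x̄₃ ⊂ M_K` with side lengths `a = d(x₁,x₂)`,
`b = d(x₁,x₃)`, `c = d(x₂,x₃)`, the distance from `x̄₂` to the point `ȳ` on the side
`[x̄₁x̄₃]` at distance `t` from `x̄₁` (law of cosines in `M_K` again). -/
noncomputable def modelCompDist (K a b c t : ℝ) : ℝ :=
  if 0 < K then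
    Real.arccos (Real.cos (Real.sqrt K * a) * Real.cos (Real.sqrt K * t)
        + Real.sin (Real.sqrt K * a) * Real.sin (Real.sqrt K * t) * modelCosAngle K a b c)
      / Real.sqrt K
  else if K < 0 then
    (let x := Real.cosh (Real.sqrt (-K) * a) * Real.cosh (Real.sqrt (-K) * t)
        - Real.sinh (Real.sqrt (-K) * a) * Real.sinh (Real.sqrt (-K) * t) * modelCosAngle K a b c
     Real.log (x + Real.sqrt (x ^ 2 - 1)) / Real.sqrt (-K))
  else Real.sqrt (a ^ 2 + t ^ 2 - 2 * a * t * modelCosAngle K a b c)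

/-- `X` is an Alexandrov space of curvature `≥ K`: around every point there is a
neighbourhood `U` such that for every geodesic triangle `Δx₁x₂x₃` in `U` and every point
`y = γ(t)` on the side `[x₁x₃]`, the distance `d(x₂,y)` is at least the corresponding
distance `d(x̄₂,ȳ)` in the comparison triangle in the model surface `M_K`. -/
def AlexandrovCurvGE (K : ℝ) (X : Type*) [MetricSpace X] : Prop :=
  ∀ x : X, ∃ U ∈ nhds x, ∀ x₁ x₂ x₃ : X, x₁ ∈ U → x₂ ∈ U → x₃ ∈ U →
    Nonempty (GeodesicIn X x₁ x₂) → Nonempty (GeodesicIn X x₂ x₃) →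
    ∀ γ : GeodesicIn X x₁ x₃, ∀ t ∈ Set.Icc (0 : ℝ) (dist x₁ x₃),
      modelCompDist K (dist x₁ x₂) (dist x₁ x₃) (dist x₂ x₃) t ≤ dist x₂ (γ.path t)

/-- The Gromov–Hausdorff distance between the rescaled ball `(1/ε)B̄_ε(x)` and the
rescaled Euclidean unit ball `(1/ε)B̄_ε(0) ⊂ ℝⁿ`, i.e.
`d_GH(B̄_ε(x), B̄_ε(0 ∈ ℝⁿ)) / ε`  (Gromov–Hausdorff distance scales linearly). -/
noncomputable def ghBallRatio (n : ℕ) {X : Type} [MetricSpace X] [ProperSpace X]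
    (x : X) (ε : ℝ) : ℝ :=
  if hε : 0 < ε then
    letI : CompactSpace (Metric.closedBall x ε) :=
      isCompact_iff_compactSpace.mp (isCompact_closedBall x ε)
    letI : CompactSpace (Metric.closedBall (0 : EuclideanSpace ℝ (Fin n)) ε) :=
      isCompact_iff_compactSpace.mp (isCompact_closedBall _ ε)
    haveI : Nonempty (Metric.closedBall x ε) := ⟨⟨x, Metric.mem_closedBall_self hε.le⟩⟩
    haveI : Nonempty (Metric.closedBall (0 : EuclideanSpace ℝ (Fin n)) ε) :=
      ⟨⟨0, Metric.mem_closedBall_self hε.le⟩⟩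
    GromovHausdorff.ghDist (Metric.closedBall x ε)
      (Metric.closedBall (0 : EuclideanSpace ℝ (Fin n)) ε) / ε
  else 0

/-- A point `x` of an `n`-dimensional space is regular if the rescaled balls
`(1/ε)B_ε(x)` converge to the Euclidean unit ball in the Gromov–Hausdorff sense as
`ε → 0`. -/
def IsRegularPoint (n : ℕ) {X : Type} [MetricSpace X] [ProperSpace X] (x : X) : Prop :=
  Filter.Tendsto (ghBallRatio n x) (nhdsWithin 0 (Set.Ioi 0)) (nhds 0)

/-- In the hyperbolic plane, shrinking two sides of a small hinge by a factor `t` shrinks the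
opposite side by at most a constant multiple of `t`. -/
lemma hyperbolic_hinge_contraction {a b c d e t : ℝ} (ha : 0 < a) (hb : 0 < b) (ha' : a ≤ 1 / 2)
    (hb' : b ≤ 1 / 2) (hc : |a - b| ≤ c) (hd : 0 ≤ d) (hd' : d ≤ 1) (ht : 0 < t)
    (h₁ : Real.cosh a * Real.cosh (t * b) - Real.sinh a * Real.sinh (t * b) *
      ((Real.cosh a * Real.cosh b - Real.cosh c) / (Real.sinh a * Real.sinh b)) ≤ Real.cosh e)
    (h₂ : Real.cosh (t * b) * Real.cosh (t * a) - Real.sinh (t * b) * Real.sinh (t * a) *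
      ((Real.cosh (t * b) * Real.cosh a - Real.cosh e) / (Real.sinh (t * b) * Real.sinh a))
        ≤ Real.cosh d) :
    1 / 4 * t * c ≤ d := by
  have sinh_le : ∀ x : ℝ, 0 < x → x ≤ 1 / 2 → Real.sinh x ≤ 2 * x := by
    intro x hx hx'
    have h1 := abs_le.1 (Real.abs_exp_sub_one_le (x := x) (by rw [abs_le]; constructor <;> linarith))
    have h2 := abs_le.1 (Real.abs_exp_sub_one_le (x := -x) (by rw [abs_le]; constructor <;> linarith))
    rw [abs_neg] at h2
    rw [abs_of_pos hx] at h1 h2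
    rw [Real.sinh_eq]
    linarith [h1.1, h1.2, h2.1, h2.2]
  have cosh_le : ∀ x : ℝ, |x| ≤ 1 → Real.cosh x ≤ 1 + x ^ 2 := by
    intro x hx
    have hx2 : x ^ 2 ≤ 1 := by rw [← sq_abs]; nlinarith [abs_nonneg x]
    have h0 : (0 : ℝ) ≤ x ^ 2 / 2 := by positivity
    have h1 := abs_le.1 (Real.abs_exp_sub_one_le (x := x ^ 2 / 2)
      (by rw [abs_of_nonneg h0]; linarith))
    rw [abs_of_nonneg h0] at h1
    linarith [Real.cosh_le_exp_half_sq x, h1.2]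
  have le_cosh : ∀ x : ℝ, 1 + x ^ 2 / 2 ≤ Real.cosh x := by
    intro x
    rw [← Real.cosh_abs, ← sq_abs]
    have h1 : |x| / 2 ≤ Real.sinh (|x| / 2) := Real.self_le_sinh_iff.2 (by positivity)
    have h2 : Real.cosh |x| = 1 + 2 * Real.sinh (|x| / 2) ^ 2 := by
      have := Real.cosh_two_mul (|x| / 2)
      rw [mul_div_cancel₀ _ (two_ne_zero)] at this
      rw [this, Real.cosh_sq]; ring
    rw [h2]
    nlinarith [abs_nonneg x]
  have hsa : 0 < Real.sinh a := Real.sinh_pos_iff.2 ha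
  have hsb : 0 < Real.sinh b := Real.sinh_pos_iff.2 hb
  have hsta : 0 < Real.sinh (t * a) := Real.sinh_pos_iff.2 (by positivity)
  have hstb : 0 < Real.sinh (t * b) := Real.sinh_pos_iff.2 (by positivity)
  have hra : t / 2 ≤ Real.sinh (t * a) / Real.sinh a := by
    rw [div_le_div_iff₀ two_pos hsa]
    have : t * a ≤ Real.sinh (t * a) := Real.self_le_sinh_iff.2 (by positivity)
    nlinarith [sinh_le a ha ha']
  have hrb : t / 2 ≤ Real.sinh (t * b) / Real.sinh b := by
    rw [div_le_div_iff₀ two_pos hsb]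
    have : t * b ≤ Real.sinh (t * b) := Real.self_le_sinh_iff.2 (by positivity)
    nlinarith [sinh_le b hb hb']
  have hr : t / 2 * (t / 2) ≤
      Real.sinh (t * a) / Real.sinh a * (Real.sinh (t * b) / Real.sinh b) := by gcongr
  have hcu : 0 ≤ Real.cosh c - Real.cosh (a - b) :=
    sub_nonneg.2 (Real.cosh_le_cosh.2 (hc.trans (le_abs_self _)))
  have key : Real.cosh (t * (a - b)) + Real.sinh (t * a) / Real.sinh a *
      (Real.sinh (t * b) / Real.sinh b) * (Real.cosh c - Real.cosh (a - b)) ≤ Real.cosh d := by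
    refine le_trans ?_ h₂
    have h₃ := mul_le_mul_of_nonneg_left h₁ (div_pos hsta hsa).le
    have e₁ : Real.cosh (t * b) * Real.cosh (t * a) - Real.sinh (t * b) * Real.sinh (t * a) *
        ((Real.cosh (t * b) * Real.cosh a - Real.cosh e) / (Real.sinh (t * b) * Real.sinh a)) =
        Real.cosh (t * b) * Real.cosh (t * a) - Real.sinh (t * a) / Real.sinh a *
          (Real.cosh (t * b) * Real.cosh a) + Real.sinh (t * a) / Real.sinh a * Real.cosh e := by
      field_simp
      ring
    rw [e₁]
    refine le_of_eq_of_le ?_ (add_le_add_right h₃ _)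
    rw [mul_sub t, Real.cosh_sub, Real.cosh_sub]
    field_simp
    ring
  have h4 := mul_le_mul_of_nonneg_right hr hcu
  have h5 := le_cosh (t * (a - b))
  have h6 : Real.cosh (a - b) ≤ 1 + (a - b) ^ 2 :=
    cosh_le _ (by rw [abs_le]; constructor <;> linarith)
  have h7 := le_cosh c
  have h8 := cosh_le d (by rw [abs_of_nonneg hd]; exact hd')
  have hc0 : 0 ≤ c := (abs_nonneg _).trans hc
  refine abs_le_of_sq_le_sq' ?_ hd |>.2
  have h9 : 0 ≤ t ^ 2 * (1 + (a - b) ^ 2 - Real.cosh (a - b)) :=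
    mul_nonneg (sq_nonneg t) (by linarith)
  have h10 : 0 ≤ t ^ 2 * (Real.cosh c - (1 + c ^ 2 / 2)) :=
    mul_nonneg (sq_nonneg t) (by linarith)
  nlinarith [sq_nonneg (t * c), sq_nonneg (t * (a - b))]

/-- On the round sphere, shrinking two sides of a small hinge by a factor `t` shrinks the
opposite side by at most a constant multiple of `t`. -/
lemma spherical_hinge_contraction {a b c d e t : ℝ} (ha : 0 < a) (hb : 0 < b) (ha' : a ≤ 1 / 2)
    (hb' : b ≤ 1 / 2) (hc : |a - b| ≤ c) (hc' : c ≤ 1) (hd : 0 ≤ d) (ht : 0 < t) (ht' : t ≤ 1)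
    (h₁ : Real.cos e ≤ Real.cos a * Real.cos (t * b) + Real.sin a * Real.sin (t * b) *
      ((Real.cos c - Real.cos a * Real.cos b) / (Real.sin a * Real.sin b)))
    (h₂ : Real.cos d ≤ Real.cos (t * b) * Real.cos (t * a) + Real.sin (t * b) * Real.sin (t * a) *
      ((Real.cos e - Real.cos (t * b) * Real.cos a) / (Real.sin (t * b) * Real.sin a))) :
    1 / 4 * t * c ≤ d := by
  have hpi := Real.pi_gt_three
  have hpi' := Real.pi_le_four
  have hta : t * a ≤ a := mul_le_of_le_one_left ha.le ht'
  have htb : t * b ≤ b := mul_le_of_le_one_left hb.le ht'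
  have hsa : 0 < Real.sin a := Real.sin_pos_of_pos_of_lt_pi ha (by linarith)
  have hsb : 0 < Real.sin b := Real.sin_pos_of_pos_of_lt_pi hb (by linarith)
  have hsta : 0 < Real.sin (t * a) :=
    Real.sin_pos_of_pos_of_lt_pi (by positivity) (by linarith)
  have hstb : 0 < Real.sin (t * b) :=
    Real.sin_pos_of_pos_of_lt_pi (by positivity) (by linarith)
  have ratio : ∀ x : ℝ, 0 < x → t * x ≤ Real.pi / 2 → 0 < Real.sin x →
      2 / Real.pi * t ≤ Real.sin (t * x) / Real.sin x := by
    intro x hx hx' hs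
    rw [le_div_iff₀ hs]
    calc 2 / Real.pi * t * Real.sin x ≤ 2 / Real.pi * t * x := by
          gcongr; exact Real.sin_le hx.le
      _ = 2 / Real.pi * (t * x) := by ring
      _ ≤ _ := Real.mul_le_sin (by positivity) hx'
  have hr : 2 / Real.pi * t * (2 / Real.pi * t) ≤
      Real.sin (t * a) / Real.sin a * (Real.sin (t * b) / Real.sin b) :=
    mul_le_mul (ratio a ha (by linarith) hsa) (ratio b hb (by linarith) hsb) (by positivity)
      (by positivity)
  have hc0 : 0 ≤ c := (abs_nonneg _).trans hc
  have hcu : 0 ≤ Real.cos (a - b) - Real.cos c := by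
    rw [← Real.cos_abs (a - b)]
    exact sub_nonneg.2 (Real.cos_le_cos_of_nonneg_of_le_pi (abs_nonneg _) (by linarith) hc)
  have key : Real.cos d ≤ Real.cos (t * (a - b)) - Real.sin (t * a) / Real.sin a *
      (Real.sin (t * b) / Real.sin b) * (Real.cos (a - b) - Real.cos c) := by
    refine h₂.trans ?_
    have h₃ := mul_le_mul_of_nonneg_left h₁ (div_pos hsta hsa).le
    have e₁ : Real.cos (t * b) * Real.cos (t * a) + Real.sin (t * b) * Real.sin (t * a) *
        ((Real.cos e - Real.cos (t * b) * Real.cos a) / (Real.sin (t * b) * Real.sin a)) =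
        Real.cos (t * b) * Real.cos (t * a) - Real.sin (t * a) / Real.sin a *
          (Real.cos (t * b) * Real.cos a) + Real.sin (t * a) / Real.sin a * Real.cos e := by
      field_simp
      ring
    rw [e₁]
    refine le_of_le_of_eq (add_le_add_right h₃ _) ?_
    rw [mul_sub t, Real.cos_sub, Real.cos_sub]
    field_simp
    ring
  have habs : |t * (a - b)| ≤ Real.pi := by
    rw [abs_mul, abs_of_pos ht]
    nlinarith [abs_nonneg (a - b)]
  have h4 := mul_le_mul_of_nonneg_right hr hcu
  have h5 := Real.cos_le_one_sub_mul_cos_sq habs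
  have h6 := Real.one_sub_sq_div_two_le_cos (x := a - b)
  have h7 := Real.cos_le_one_sub_mul_cos_sq (x := c) (by rw [abs_of_nonneg hc0]; linarith)
  have h8 := Real.one_sub_sq_div_two_le_cos (x := d)
  have hP : 1 / 8 ≤ 2 / Real.pi ^ 2 := by
    rw [div_le_div_iff₀ (by norm_num) (by positivity)]
    nlinarith
  have hP' : 2 / Real.pi * t * (2 / Real.pi * t) = 2 * (2 / Real.pi ^ 2) * t ^ 2 := by
    field_simp
  rw [hP'] at h4
  set P := 2 / Real.pi ^ 2
  have h9 : 0 ≤ 2 * P * t ^ 2 * (Real.cos (a - b) - (1 - (a - b) ^ 2 / 2)) :=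
    mul_nonneg (by positivity) (by linarith)
  have h10 : 0 ≤ 2 * P * t ^ 2 * (1 - P * c ^ 2 - Real.cos c) :=
    mul_nonneg (by positivity) (by linarith)
  have h11 : 1 / 64 * (t * c) ^ 2 ≤ P ^ 2 * (t * c) ^ 2 := by
    gcongr
    nlinarith
  refine abs_le_of_sq_le_sq' ?_ hd |>.2
  linarith

lemma Real.cos_le_of_arccos_le {x y : ℝ} (hy : 0 ≤ y) (hy' : y < Real.pi)
    (h : Real.arccos x ≤ y) : Real.cos y ≤ x := by
  by_contra! hlt
  rcases le_or_gt x (-1) with hx | hx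
  · rw [Real.arccos_of_le_neg_one hx] at h
    linarith
  · have := Real.arccos_lt_arccos hx.le hlt (Real.cos_le_one y)
    rw [Real.arccos_cos hy hy'.le] at this
    linarith

lemma Real.le_cosh_of_arcosh_le {x y : ℝ} (h : Real.arcosh x ≤ y) : x ≤ Real.cosh y := by
  rcases le_total x 1 with hx | hx
  · exact hx.trans (Real.one_le_cosh y)
  · rw [← Real.cosh_arcosh hx, Real.cosh_le_cosh, abs_of_nonneg (Real.arcosh_nonneg hx)]
    exact h.trans (le_abs_self y)

/-- Two successive model comparisons bound from below the side opposite to a hinge whose sides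
have been shrunk by a factor `t`. -/
lemma exists_hinge_contraction (K : ℝ) : ∃ ρ : ℝ, 0 < ρ ∧ ∀ a b c d e t : ℝ, 0 < a → 0 < b →
    a ≤ ρ → b ≤ ρ → |a - b| ≤ c → c ≤ 2 * ρ → 0 ≤ d → d ≤ 2 * ρ → 0 ≤ e → e ≤ 2 * ρ →
    0 < t → t ≤ 1 → modelCompDist K a b c (t * b) ≤ e → modelCompDist K (t * b) a e (t * a) ≤ d →
    1 / 4 * t * c ≤ d := by
  rcases lt_trichotomy K 0 with hK | rfl | hK
  · have hk : 0 < √(-K) := Real.sqrt_pos.2 (by linarith)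
    refine ⟨1 / (2 * √(-K)), by positivity, ?_⟩
    intro a b c d e t ha hb ha' hb' hc hc' hd hd' he he' ht ht' h₁ h₂
    simp only [modelCompDist, modelCosAngle, if_neg hK.not_gt, if_pos hK] at h₁ h₂
    rw [div_le_iff₀' hk] at h₁ h₂
    replace h₁ := Real.le_cosh_of_arcosh_le h₁
    replace h₂ := Real.le_cosh_of_arcosh_le h₂
    set k := √(-K)
    have scale : k * (1 / (2 * k)) = 1 / 2 := by field_simp
    have := hyperbolic_hinge_contraction (a := k * a) (b := k * b) (c := k * c) (d := k * d)
      (e := k * e) (t := t) (by positivity) (by positivity)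
      ((mul_le_mul_of_nonneg_left ha' hk.le).trans_eq scale)
      ((mul_le_mul_of_nonneg_left hb' hk.le).trans_eq scale)
      (by rw [← mul_sub, abs_mul, abs_of_pos hk]; gcongr) (by positivity)
      (by linarith [mul_le_mul_of_nonneg_left hd' hk.le]) ht
      (by simpa only [mul_left_comm t k] using h₁) (by simpa only [mul_left_comm t k] using h₂)
    exact le_of_mul_le_mul_left (by linarith) hk
  · refine ⟨1, one_pos, ?_⟩
    intro a b c d e t ha hb ha' hb' hc hc' hd hd' he he' ht ht' h₁ h₂
    simp only [modelCompDist, modelCosAngle, lt_irrefl, if_false] at h₁ h₂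
    have hc0 : 0 ≤ c := (abs_nonneg _).trans hc
    rw [Real.sqrt_le_left he] at h₁
    rw [Real.sqrt_le_left hd] at h₂
    have e₁ : a ^ 2 + (t * b) ^ 2 - 2 * a * (t * b) * ((a ^ 2 + b ^ 2 - c ^ 2) / (2 * a * b)) =
        a ^ 2 + (t * b) ^ 2 - t * (a ^ 2 + b ^ 2 - c ^ 2) := by
      field_simp
    have e₂ : (t * b) ^ 2 + (t * a) ^ 2 -
        2 * (t * b) * (t * a) * (((t * b) ^ 2 + a ^ 2 - e ^ 2) / (2 * (t * b) * a)) =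
        (t * b) ^ 2 + (t * a) ^ 2 - t * ((t * b) ^ 2 + a ^ 2 - e ^ 2) := by
      field_simp
    rw [e₁] at h₁
    rw [e₂] at h₂
    refine abs_le_of_sq_le_sq' ?_ hd |>.2
    nlinarith [mul_le_mul_of_nonneg_left h₁ ht.le, sq_nonneg (t * c)]
  · have hk : 0 < √K := Real.sqrt_pos.2 hK
    refine ⟨1 / (2 * √K), by positivity, ?_⟩
    intro a b c d e t ha hb ha' hb' hc hc' hd hd' he he' ht ht' h₁ h₂
    simp only [modelCompDist, modelCosAngle, if_pos hK] at h₁ h₂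
    rw [div_le_iff₀' hk] at h₁ h₂
    set k := √K
    have hpi := Real.pi_gt_three
    have scale : k * (1 / (2 * k)) = 1 / 2 := by field_simp
    replace h₁ := Real.cos_le_of_arccos_le (by positivity)
      (by linarith [mul_le_mul_of_nonneg_left he' hk.le]) h₁
    replace h₂ := Real.cos_le_of_arccos_le (by positivity)
      (by linarith [mul_le_mul_of_nonneg_left hd' hk.le]) h₂
    have := spherical_hinge_contraction (a := k * a) (b := k * b) (c := k * c) (d := k * d)
      (e := k * e) (t := t) (by positivity) (by positivity)
      ((mul_le_mul_of_nonneg_left ha' hk.le).trans_eq scale)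
      ((mul_le_mul_of_nonneg_left hb' hk.le).trans_eq scale)
      (by rw [← mul_sub, abs_mul, abs_of_pos hk]; gcongr)
      (by linarith [mul_le_mul_of_nonneg_left hc' hk.le]) (by positivity) ht ht'
      (by simpa only [mul_left_comm t k] using h₁) (by simpa only [mul_left_comm t k] using h₂)
    exact le_of_mul_le_mul_left (by linarith) hk

lemma GeodesicIn.dist_source {X : Type*} [MetricSpace X] {x y : X} (γ : GeodesicIn X x y) {s : ℝ}
    (hs : s ∈ Set.Icc (0 : ℝ) (dist x y)) : dist x (γ.path s) = s := by
  have := γ.isom (left_mem_Icc.2 dist_nonneg) hs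
  rwa [γ.source, zero_sub, abs_neg, abs_of_nonneg hs.1] at this

/-- Around every point of a geodesic space with curvature bounded below, the homotheties along
geodesics towards a nearby centre `q` are expanding up to a constant after rescaling. -/
lemma AlexandrovCurvGE.exists_homothety {X : Type*} [MetricSpace X] {K : ℝ}
    (hK : AlexandrovCurvGE K X) (geo : ∀ x y : X, Nonempty (GeodesicIn X x y)) (x : X) :
    ∃ r : ℝ, 0 < r ∧ ∀ q, dist x q ≤ r → ∃ f : ℝ → X → X, ∀ t, 0 < t → t ≤ 1 →
      ∀ y, dist q y ≤ 2 * r → dist q (f t y) = t * dist q y ∧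
        ∀ z, dist q z ≤ 2 * r → 1 / 4 * t * dist y z ≤ dist (f t y) (f t z) := by
  obtain ⟨U, hU, hcomp⟩ := hK x
  obtain ⟨s, hs, hsU⟩ := Metric.mem_nhds_iff.1 hU
  obtain ⟨ρ, hρ, hinge⟩ := exists_hinge_contraction K
  refine ⟨min (s / 4) (ρ / 2), by positivity, fun q hq => ?_⟩
  set r := min (s / 4) (ρ / 2)
  have hrs : r ≤ s / 4 := min_le_left _ _
  have hrρ : r ≤ ρ / 2 := min_le_right _ _
  let γ : ∀ y, GeodesicIn X q y := fun y => (geo q y).some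
  have hmem : ∀ y, dist q y ≤ 2 * r → y ∈ U := fun y hy => hsU (by
    rw [Metric.mem_ball']
    linarith [dist_triangle x q y])
  have hqU : q ∈ U := hmem q (by rw [dist_self]; positivity)
  refine ⟨fun t y => (γ y).path (t * dist q y), fun t ht ht' => ?_⟩
  have hIcc : ∀ y, t * dist q y ∈ Set.Icc (0 : ℝ) (dist q y) := fun y =>
    ⟨by positivity, mul_le_of_le_one_left dist_nonneg ht'⟩
  have hdist : ∀ y, dist q ((γ y).path (t * dist q y)) = t * dist q y := fun y =>
    (γ y).dist_source (hIcc y)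
  refine fun y hy => ⟨hdist y, fun z hz => ?_⟩
  beta_reduce
  rcases eq_or_ne q y with rfl | hqy
  · have : (γ q).path (t * dist q q) = q := by
      rw [dist_self, mul_zero, (γ q).source]
    rw [this, hdist z]
    nlinarith [dist_nonneg (x := q) (y := z), mul_nonneg ht.le (dist_nonneg (x := q) (y := z))]
  rcases eq_or_ne q z with rfl | hqz
  · have : (γ q).path (t * dist q q) = q := by
      rw [dist_self, mul_zero, (γ q).source]
    rw [this, dist_comm y q, dist_comm _ q, hdist y]
    nlinarith [dist_nonneg (x := q) (y := y), mul_nonneg ht.le (dist_nonneg (x := q) (y := y))]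
  set y' := (γ y).path (t * dist q y)
  set z' := (γ z).path (t * dist q z)
  have hy' : dist q y' ≤ 2 * r := (hdist y).trans_le ((hIcc y).2.trans hy)
  have hz' : dist q z' ≤ 2 * r := (hdist z).trans_le ((hIcc z).2.trans hz)
  have h₁ := hcomp q y z hqU (hmem y hy) (hmem z hz) (geo q y) (geo y z) (γ z) _ (hIcc z)
  have h₂ := hcomp q z' y hqU (hmem z' hz') (hmem y hy) (geo q z') (geo z' y) (γ y) _ (hIcc y)
  rw [hdist z, dist_comm z' y] at h₂
  rw [dist_comm y' z']
  refine hinge (dist q y) (dist q z) (dist y z) _ _ t (dist_pos.2 hqy) (dist_pos.2 hqz)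
    (by linarith) (by linarith) ?_ ?_ dist_nonneg ?_ dist_nonneg ?_ ht ht' h₁ h₂
  · rw [dist_comm q y, dist_comm q z]
    exact abs_dist_sub_le y z q
  · linarith [dist_triangle_left y z q]
  · linarith [dist_triangle_left z' y' q]
  · linarith [dist_triangle_left y z' q]

lemma dimH_le_of_mul_dist_le {X Y : Type*} [MetricSpace X] [MetricSpace Y] {f : X → Y} {s : Set X}
    {t : Set Y} {c : ℝ} (hc : 0 < c) (hst : Set.MapsTo f s t)
    (hf : ∀ y ∈ s, ∀ z ∈ s, c * dist y z ≤ dist (f y) (f z)) : dimH s ≤ dimH t := by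
  have hanti : AntilipschitzWith (Real.toNNReal c⁻¹) (s.domRestrict f) := by
    refine AntilipschitzWith.of_le_mul_dist fun y z => ?_
    rw [Real.coe_toNNReal _ (by positivity), ← div_eq_inv_mul, le_div_iff₀' hc]
    exact hf y y.2 z z.2
  have h := hanti.le_dimH_image Set.univ
  rw [← isometry_subtype_coe.dimH_image, Set.image_univ, Subtype.range_coe, Set.image_univ,
    Set.range_domRestrict] at h
  exact h.trans (dimH_mono hst.image_subset)

lemma preconnectedSpace_of_geodesicIn {X : Type*} [MetricSpace X]
    (geo : ∀ x y : X, Nonempty (GeodesicIn X x y)) : PreconnectedSpace X := by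
  refine ⟨isPreconnected_of_forall_pair fun x _ y _ => ?_⟩
  obtain ⟨γ⟩ := geo x y
  have hcont : ContinuousOn γ.path (Set.Icc 0 (dist x y)) := by
    refine LipschitzOnWith.continuousOn (K := 1) (LipschitzOnWith.of_dist_le_mul ?_)
    intro s hs t ht
    rw [γ.isom hs ht, NNReal.coe_one, one_mul, Real.dist_eq]
  exact ⟨γ.path '' Set.Icc 0 (dist x y), Set.subset_univ _,
    ⟨0, left_mem_Icc.2 dist_nonneg, γ.source⟩, ⟨_, right_mem_Icc.2 dist_nonneg, γ.target⟩,
    isPreconnected_Icc.image _ hcont⟩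

/-- In a geodesic space with curvature bounded below, the Hausdorff dimension is bounded by that
of an arbitrary ball. -/
lemma AlexandrovCurvGE.dimH_univ_le {X : Type*} [MetricSpace X] [SecondCountableTopology X] {K : ℝ}
    (hK : AlexandrovCurvGE K X) (geo : ∀ x y : X, Nonempty (GeodesicIn X x y)) {x : X} {R : ℝ}
    (hR : 0 < R) {k : ENNReal} (hk : dimH (closedBall x R) ≤ k) :
    dimH (Set.univ : Set X) ≤ k := by
  have := preconnectedSpace_of_geodesicIn geo
  let S : Set X := {q | ∃ r : ℝ, 0 < r ∧ dimH (closedBall q r) ≤ k}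
  have hopen : IsOpen S := by
    refine Metric.isOpen_iff.2 fun q ⟨r, hr, hqr⟩ => ⟨r / 2, by positivity, fun p hp => ?_⟩
    refine ⟨r / 2, by positivity, (dimH_mono (closedBall_subset_closedBall' ?_)).trans hqr⟩
    linarith [Metric.mem_ball.1 hp]
  have hclosed : IsClosed S := by
    refine isClosed_of_closure_subset fun q hq => ?_
    obtain ⟨r, hr, hom⟩ := hK.exists_homothety geo q
    obtain ⟨p, ⟨r', hr', hp⟩, hqp⟩ := Metric.mem_closure_iff.1 hq r hr
    obtain ⟨f, hf⟩ := hom p hqp.le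
    refine ⟨r, hr, ?_⟩
    obtain ⟨t, ht, ht', htr⟩ : ∃ t : ℝ, 0 < t ∧ t ≤ 1 ∧ t * (2 * r) ≤ r' :=
      ⟨min 1 (r' / (2 * r)), by positivity, min_le_left _ _,
        (le_div_iff₀ (by positivity)).1 (min_le_right _ _)⟩
    calc dimH (closedBall q r) ≤ dimH (closedBall p (2 * r)) :=
          dimH_mono (closedBall_subset_closedBall' (by linarith))
      _ ≤ dimH (closedBall p r') := by
          refine dimH_le_of_mul_dist_le (f := f t) (c := 1 / 4 * t) (by positivity) ?_ ?_
          · intro y hy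
            rw [Metric.mem_closedBall'] at hy ⊢
            rw [(hf t ht ht' y hy).1]
            exact (mul_le_mul_of_nonneg_left hy ht.le).trans htr
          · intro y hy z hz
            rw [Metric.mem_closedBall'] at hy hz
            exact (hf t ht ht' y hy).2 z hz
      _ ≤ k := hp
  have huniv : S = Set.univ := IsClopen.eq_univ ⟨hclosed, hopen⟩ ⟨x, R, hR, hk⟩
  by_contra! hlt
  obtain ⟨q, -, hq⟩ := exists_mem_nhdsWithin_lt_dimH_of_lt_dimH hlt
  obtain ⟨r, hr, hqr⟩ : q ∈ S := huniv ▸ Set.mem_univ q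
  exact absurd (hq _ (mem_nhdsWithin_of_mem_nhds (closedBall_mem_nhds q hr))) hqr.not_gt

section Blowup

open Filter Topology

/-- Families of points `y ε` lying in the closed balls `B_ε(x)`. -/
def blowupFamilies {X : Type*} [MetricSpace X] (x : X) : Set (ℝ → X) :=
  {y | ∀ ε, 0 < ε → dist (y ε) x ≤ ε}

/-- The rescaled balls `(1/ε)B_ε(x)` converge along the ultrafilter `𝒰` to the unit ball of `E`:
the limit map `L` sends families of points in these balls to `E`, preserves limit distances and has
dense image in the unit ball. -/
def HasBlowup (𝒰 : Ultrafilter ℝ) {X : Type*} [MetricSpace X] (x : X) (E : Type*)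
    [NormedAddCommGroup E] : Prop :=
  ∃ L : (ℝ → X) → E,
    (∀ y ∈ blowupFamilies x, ∀ z ∈ blowupFamilies x,
      Tendsto (fun ε => dist (y ε) (z ε) / ε) 𝒰 (𝓝 (dist (L y) (L z)))) ∧
    closedBall 0 1 ⊆ closure (L '' blowupFamilies x)

variable {X : Type*} [MetricSpace X] {x : X} {𝒰 : Ultrafilter ℝ}

lemma const_mem_blowupFamilies (x : X) : (fun _ => x) ∈ blowupFamilies x := fun ε hε => by
  rw [dist_self]; exact hε.le

lemma dist_limit_const_le_one {E : Type*} [NormedAddCommGroup E] {L : (ℝ → X) → E}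
    (h𝒰 : (𝒰 : Filter ℝ) ≤ 𝓝[>] 0)
    (hL : ∀ y ∈ blowupFamilies x, ∀ z ∈ blowupFamilies x,
      Tendsto (fun ε => dist (y ε) (z ε) / ε) 𝒰 (𝓝 (dist (L y) (L z))))
    {y : ℝ → X} (hy : y ∈ blowupFamilies x) : dist (L y) (L fun _ => x) ≤ 1 := by
  refine le_of_tendsto (hL y hy _ (const_mem_blowupFamilies x)) ?_
  filter_upwards [h𝒰 self_mem_nhdsWithin] with ε hε
  exact (div_le_one hε).2 (hy ε hε)

lemma limit_const_eq_zero {E : Type*} [NormedAddCommGroup E] [NormedSpace ℝ E] {L : (ℝ → X) → E}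
    (h𝒰 : (𝒰 : Filter ℝ) ≤ 𝓝[>] 0)
    (hL : ∀ y ∈ blowupFamilies x, ∀ z ∈ blowupFamilies x,
      Tendsto (fun ε => dist (y ε) (z ε) / ε) 𝒰 (𝓝 (dist (L y) (L z))))
    (hdense : closedBall 0 1 ⊆ closure (L '' blowupFamilies x)) : L (fun _ => x) = 0 := by
  by_contra hne
  set v := L fun _ => x
  have hv : 0 < ‖v‖ := norm_pos_iff.2 hne
  have hsub : closure (L '' blowupFamilies x) ⊆ closedBall v 1 :=
    closure_minimal (by rintro _ ⟨y, hy, rfl⟩; exact dist_limit_const_le_one h𝒰 hL hy)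
      isClosed_closedBall
  have hmem : -(‖v‖⁻¹ • v) ∈ closedBall (0 : E) 1 := by
    rw [mem_closedBall_zero_iff, norm_neg, norm_smul, norm_inv, norm_norm,
      inv_mul_cancel₀ hv.ne']
  have h := hsub (hdense hmem)
  have e : -(‖v‖⁻¹ • v) - v = -((‖v‖⁻¹ + 1) • v) := by rw [add_smul, one_smul]; abel
  rw [mem_closedBall, dist_eq_norm, e, norm_neg, norm_smul, Real.norm_of_nonneg (by positivity),
    add_mul, inv_mul_cancel₀ hv.ne'] at h
  linarith

lemma HasBlowup.congr {E F : Type*} [NormedAddCommGroup E] [NormedSpace ℝ E]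
    [NormedAddCommGroup F] [NormedSpace ℝ F] (h : HasBlowup 𝒰 x E) (e : E ≃ₗᵢ[ℝ] F) :
    HasBlowup 𝒰 x F := by
  obtain ⟨L, hL, hdense⟩ := h
  refine ⟨e ∘ L, fun y hy z hz => ?_, fun v hv => ?_⟩
  · simpa only [Function.comp_apply, e.dist_map] using hL y hy z hz
  · rw [Set.image_comp]
    have h1 : e.symm v ∈ closure (L '' blowupFamilies x) :=
      hdense (by simpa using hv)
    simpa using image_closure_subset_closure_image e.continuous ⟨_, h1, rfl⟩

lemma HasBlowup.euclidean {E : Type*} [NormedAddCommGroup E] [InnerProductSpace ℝ E]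
    [FiniteDimensional ℝ E] (h : HasBlowup 𝒰 x E) {k : ℕ} (hk : Module.finrank ℝ E = k) :
    HasBlowup 𝒰 x (EuclideanSpace ℝ (Fin k)) := by
  subst hk
  exact h.congr (stdOrthonormalBasis ℝ E).repr

/-- A Euclidean blow-up at one point bounds the Hausdorff dimension of the space. -/
lemma AlexandrovCurvGE.dimH_le_of_hasBlowup [SecondCountableTopology X] {K : ℝ}
    (hK : AlexandrovCurvGE K X) (geo : ∀ x y : X, Nonempty (GeodesicIn X x y))
    (h𝒰 : (𝒰 : Filter ℝ) ≤ 𝓝[>] 0) {k : ℕ} (h : HasBlowup 𝒰 x (EuclideanSpace ℝ (Fin k))) :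
    dimH (Set.univ : Set X) ≤ k := by
  obtain ⟨L, hL, -⟩ := h
  obtain ⟨r, hr, hom⟩ := hK.exists_homothety geo x
  obtain ⟨f, hf⟩ := hom x (by rw [dist_self]; exact hr.le)
  refine hK.dimH_univ_le geo (x := x) (R := 2 * r) (by positivity) ?_
  have hrpos : 0 < 2 * r := by positivity
  let g : X → ℝ → X := fun y ε => if 0 < ε ∧ ε ≤ 2 * r then f (ε / (2 * r)) y else x
  have hg : ∀ y, dist x y ≤ 2 * r → g y ∈ blowupFamilies x := by
    intro y hy ε hε
    by_cases hε' : 0 < ε ∧ ε ≤ 2 * r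
    · have h1 := (hf (ε / (2 * r)) (by positivity) ((div_le_one hrpos).2 hε'.2) y hy).1
      simp only [g, if_pos hε']
      rw [dist_comm, h1, div_mul_eq_mul_div, div_le_iff₀ hrpos]
      gcongr
    · simpa only [g, if_neg hε', dist_self] using hε.le
  have hsmall : ∀ᶠ ε in (𝒰 : Filter ℝ), 0 < ε ∧ ε ≤ 2 * r :=
    h𝒰 (Ioc_mem_nhdsGT hrpos)
  calc dimH (closedBall x (2 * r))
      ≤ dimH (Set.univ : Set (EuclideanSpace ℝ (Fin k))) := by
        refine dimH_le_of_mul_dist_le (f := fun y => L (g y)) (c := 1 / 4 / (2 * r))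
          (by positivity) (Set.mapsTo_univ _ _) fun y hy z hz => ?_
        rw [Metric.mem_closedBall'] at hy hz
        refine ge_of_tendsto (hL _ (hg y hy) _ (hg z hz)) ?_
        filter_upwards [hsmall] with ε hε
        simp only [g, if_pos hε]
        rw [le_div_iff₀ hε.1]
        refine le_of_eq_of_le ?_ ((hf (ε / (2 * r)) (div_pos hε.1 hrpos)
          ((div_le_one hrpos).2 hε.2) y hy).2 z hz)
        ring
    _ = k := by rw [Real.dimH_univ_eq_finrank, finrank_euclideanSpace_fin]

lemma limit_eq_of_eventuallyEq {E : Type*} [NormedAddCommGroup E] {L : (ℝ → X) → E}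
    (hL : ∀ y ∈ blowupFamilies x, ∀ z ∈ blowupFamilies x,
      Tendsto (fun ε => dist (y ε) (z ε) / ε) 𝒰 (𝓝 (dist (L y) (L z))))
    {y z : ℝ → X} (hy : y ∈ blowupFamilies x) (hz : z ∈ blowupFamilies x)
    (hyz : y =ᶠ[𝒰] z) : L y = L z := by
  refine dist_eq_zero.1 (tendsto_nhds_unique (hL y hy z hz) (tendsto_const_nhds.congr' ?_))
  filter_upwards [hyz] with ε hε
  rw [hε, dist_self, zero_div]

lemma WithLp.prod_dist_sq {X₁ X₂ : Type*} [MetricSpace X₁] [MetricSpace X₂]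
    (p q : WithLp 2 (X₁ × X₂)) :
    dist p q ^ 2 = dist p.fst q.fst ^ 2 + dist p.snd q.snd ^ 2 := by
  rw [WithLp.prod_dist_eq_add (by norm_num)]
  simp only [ENNReal.toReal_ofNat, Real.rpow_ofNat]
  rw [← Real.sqrt_eq_rpow, Real.sq_sqrt (by positivity)]

section Product

variable {X₁ X₂ : Type*} [MetricSpace X₁] [MetricSpace X₂]

lemma tendsto_dist_div_of_sq {p q : ℝ → WithLp 2 (X₁ × X₂)} {a b c : ℝ}
    (h𝒰 : (𝒰 : Filter ℝ) ≤ 𝓝[>] 0) (hc : 0 ≤ c) (habc : c ^ 2 = a ^ 2 + b ^ 2)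
    (ha : Tendsto (fun ε => dist (p ε).fst (q ε).fst / ε) 𝒰 (𝓝 a))
    (hb : Tendsto (fun ε => dist (p ε).snd (q ε).snd / ε) 𝒰 (𝓝 b)) :
    Tendsto (fun ε => dist (p ε) (q ε) / ε) 𝒰 (𝓝 c) := by
  rw [← Real.sqrt_sq hc, habc]
  refine (((ha.pow 2).add (hb.pow 2)).sqrt).congr' ?_
  filter_upwards [h𝒰 self_mem_nhdsWithin] with ε hε
  have hε' : (0 : ℝ) < ε := hε
  rw [div_pow, div_pow, ← add_div, ← WithLp.prod_dist_sq, ← div_pow, Real.sqrt_sq (by positivity)]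

lemma HasBlowup.prod {E₁ E₂ : Type*} [NormedAddCommGroup E₁] [InnerProductSpace ℝ E₁]
    [NormedAddCommGroup E₂] [InnerProductSpace ℝ E₂] {x : WithLp 2 (X₁ × X₂)}
    (h𝒰 : (𝒰 : Filter ℝ) ≤ 𝓝[>] 0) (h₁ : HasBlowup 𝒰 x.fst E₁) (h₂ : HasBlowup 𝒰 x.snd E₂) :
    HasBlowup 𝒰 x (WithLp 2 (E₁ × E₂)) := by
  obtain ⟨L₁, hL₁, hd₁⟩ := h₁
  obtain ⟨L₂, hL₂, hd₂⟩ := h₂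
  have hfst : ∀ y ∈ blowupFamilies x, (fun ε => (y ε).fst) ∈ blowupFamilies x.fst :=
    fun y hy ε hε => (WithLp.dist_fst_le _ _).trans (hy ε hε)
  have hsnd : ∀ y ∈ blowupFamilies x, (fun ε => (y ε).snd) ∈ blowupFamilies x.snd :=
    fun y hy ε hε => (WithLp.dist_snd_le _ _).trans (hy ε hε)
  have hsq : ∀ v w : WithLp 2 (E₁ × E₂),
      dist v w ^ 2 = dist v.fst w.fst ^ 2 + dist v.snd w.snd ^ 2 := fun v w => by
    rw [WithLp.prod_dist_eq_of_L2, Real.sq_sqrt (by positivity)]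
  refine ⟨fun y => WithLp.toLp 2 (L₁ fun ε => (y ε).fst, L₂ fun ε => (y ε).snd),
    fun y hy z hz => ?_, ?_⟩
  · exact tendsto_dist_div_of_sq h𝒰 dist_nonneg (hsq _ _)
      (hL₁ _ (hfst y hy) _ (hfst z hz)) (hL₂ _ (hsnd y hy) _ (hsnd z hz))
  rw [← closure_ball (0 : WithLp 2 (E₁ × E₂)) one_ne_zero]
  refine closure_minimal (fun v hv => ?_) isClosed_closure
  rw [Metric.mem_closure_iff]
  intro δ hδ
  rw [mem_ball] at hv
  have hnorm := hsq v 0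
  have hv₁ : v.fst ∈ closure (L₁ '' blowupFamilies x.fst) := hd₁ <| by
    rw [mem_closedBall]
    exact (abs_le_of_sq_le_sq' (by rw [hnorm]; exact le_add_of_nonneg_right (sq_nonneg _))
      dist_nonneg).2.trans hv.le
  have hv₂ : v.snd ∈ closure (L₂ '' blowupFamilies x.snd) := hd₂ <| by
    rw [mem_closedBall]
    exact (abs_le_of_sq_le_sq' (by rw [hnorm]; exact le_add_of_nonneg_left (sq_nonneg _))
      dist_nonneg).2.trans hv.le
  obtain ⟨η, hη, hηδ, hη1⟩ : ∃ η, 0 < η ∧ η ≤ δ ∧ η ≤ 1 - dist v 0 :=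
    ⟨min δ (1 - dist v 0), lt_min hδ (by linarith), min_le_left _ _, min_le_right _ _⟩
  obtain ⟨_, ⟨y₁, hy₁, rfl⟩, hvy₁⟩ := Metric.mem_closure_iff.1 hv₁ (η / 2) (by positivity)
  obtain ⟨_, ⟨y₂, hy₂, rfl⟩, hvy₂⟩ := Metric.mem_closure_iff.1 hv₂ (η / 2) (by positivity)
  have hdist : dist v (WithLp.toLp 2 (L₁ y₁, L₂ y₂)) < η := by
    refine abs_lt_of_sq_lt_sq' ?_ hη.le |>.2
    rw [hsq]
    have h1 : dist v.fst (L₁ y₁) ^ 2 ≤ (η / 2) ^ 2 := by gcongr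
    have h2 : dist v.snd (L₂ y₂) ^ 2 ≤ (η / 2) ^ 2 := by gcongr
    change dist v.fst (L₁ y₁) ^ 2 + dist v.snd (L₂ y₂) ^ 2 < η ^ 2
    nlinarith
  have hlt : dist (WithLp.toLp 2 (L₁ y₁, L₂ y₂)) (0 : WithLp 2 (E₁ × E₂)) < 1 := by
    linarith [dist_triangle_left (WithLp.toLp 2 (L₁ y₁, L₂ y₂)) (0 : WithLp 2 (E₁ × E₂)) v]
  have hlim : Tendsto (fun ε => dist (WithLp.toLp 2 (y₁ ε, y₂ ε)) x / ε) 𝒰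
      (𝓝 (dist (WithLp.toLp 2 (L₁ y₁, L₂ y₂)) (0 : WithLp 2 (E₁ × E₂)))) := by
    refine tendsto_dist_div_of_sq h𝒰 dist_nonneg (hsq _ _) ?_ ?_
    · have := hL₁ y₁ hy₁ _ (const_mem_blowupFamilies x.fst)
      rwa [limit_const_eq_zero h𝒰 hL₁ hd₁] at this
    · have := hL₂ y₂ hy₂ _ (const_mem_blowupFamilies x.snd)
      rwa [limit_const_eq_zero h𝒰 hL₂ hd₂] at this
  have hev : ∀ᶠ ε in (𝒰 : Filter ℝ), dist (WithLp.toLp 2 (y₁ ε, y₂ ε)) x ≤ ε := by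
    filter_upwards [hlim.eventually (gt_mem_nhds hlt), h𝒰 self_mem_nhdsWithin] with ε h1 h2
    exact ((div_lt_one h2).1 h1).le
  classical
  let y : ℝ → WithLp 2 (X₁ × X₂) := fun ε =>
    if dist (WithLp.toLp 2 (y₁ ε, y₂ ε)) x ≤ ε then WithLp.toLp 2 (y₁ ε, y₂ ε) else x
  have hy : y ∈ blowupFamilies x := by
    intro ε hε
    by_cases h : dist (WithLp.toLp 2 (y₁ ε, y₂ ε)) x ≤ ε
    · simpa only [y, if_pos h] using h
    · simpa only [y, if_neg h, dist_self] using hε.le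
  have hyev : ∀ᶠ ε in (𝒰 : Filter ℝ), y ε = WithLp.toLp 2 (y₁ ε, y₂ ε) := by
    filter_upwards [hev] with ε hε
    simp only [y, if_pos hε]
  refine ⟨_, ⟨y, hy, rfl⟩, lt_of_lt_of_le ?_ hηδ⟩
  beta_reduce
  rwa [limit_eq_of_eventuallyEq hL₁ (hfst y hy) hy₁ (hyev.mono fun _ => congrArg WithLp.fst),
    limit_eq_of_eventuallyEq hL₂ (hsnd y hy) hy₂ (hyev.mono fun _ => congrArg WithLp.snd)]

lemma HasBlowup.of_mem_submodule {E : Type*} [NormedAddCommGroup E] [NormedSpace ℝ E]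
    (V : Submodule ℝ E) (L : (ℝ → X) → E) (hV : ∀ y ∈ blowupFamilies x, L y ∈ V)
    (hL : ∀ y ∈ blowupFamilies x, ∀ z ∈ blowupFamilies x,
      Tendsto (fun ε => dist (y ε) (z ε) / ε) 𝒰 (𝓝 (dist (L y) (L z))))
    (hdense : ∀ v ∈ V, ‖v‖ ≤ 1 → v ∈ closure (L '' blowupFamilies x)) : HasBlowup 𝒰 x V := by
  classical
  refine ⟨fun y => if h : y ∈ blowupFamilies x then ⟨L y, hV y h⟩ else 0, fun y hy z hz => ?_,
    fun v hv => ?_⟩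
  · simpa only [dif_pos hy, dif_pos hz, Subtype.dist_eq] using hL y hy z hz
  · rw [Metric.mem_closure_iff]
    intro δ hδ
    obtain ⟨_, ⟨y, hy, rfl⟩, hvy⟩ := Metric.mem_closure_iff.1
      (hdense v v.2 (by simpa using hv)) δ hδ
    exact ⟨_, ⟨y, hy, rfl⟩, by simpa only [dif_pos hy, Subtype.dist_eq] using hvy⟩

lemma mem_closure_of_orthogonal_add {E : Type*} [NormedAddCommGroup E] [InnerProductSpace ℝ E]
    {A B : Set E} (hAB : ∀ a ∈ A, ∀ b ∈ B, inner ℝ a b = 0) {v : E}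
    (hv : v ∈ Submodule.span ℝ A) (hcl : v ∈ closure (Set.image2 (· + ·) A B)) : v ∈ closure A := by
  rw [Metric.mem_closure_iff] at hcl ⊢
  intro δ hδ
  obtain ⟨_, ⟨a, ha, b, hb, rfl⟩, hab⟩ := hcl δ hδ
  refine ⟨a, ha, lt_of_le_of_lt ?_ hab⟩
  have hb' : b ∈ (Submodule.span ℝ A)ᗮ := by
    rw [Submodule.mem_orthogonal]
    intro u hu
    induction hu using Submodule.span_induction with
    | mem u hu => exact hAB u hu b hb
    | zero => exact inner_zero_left _
    | add u w _ _ hu hw => rw [inner_add_left, hu, hw, add_zero]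
    | smul c u _ hu => rw [inner_smul_left, hu, mul_zero]
  have horth : inner ℝ (v - a) b = 0 :=
    Submodule.inner_right_of_mem_orthogonal
      (Submodule.sub_mem _ hv (Submodule.subset_span ha)) hb'
  have h := norm_sub_sq_real (v - a) b
  rw [horth] at h
  simp only [dist_eq_norm]
  rw [← sub_sub]
  exact abs_le_of_sq_le_sq' (by nlinarith [sq_nonneg ‖b‖]) (norm_nonneg _) |>.2

lemma HasBlowup.exists_split {E : Type*} [NormedAddCommGroup E] [InnerProductSpace ℝ E]
    [FiniteDimensional ℝ E] {x : WithLp 2 (X₁ × X₂)} (h𝒰 : (𝒰 : Filter ℝ) ≤ 𝓝[>] 0)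
    (h : HasBlowup 𝒰 x E) :
    ∃ k₁ k₂ : ℕ, k₁ + k₂ = Module.finrank ℝ E ∧
      HasBlowup 𝒰 x.fst (EuclideanSpace ℝ (Fin k₁)) ∧
      HasBlowup 𝒰 x.snd (EuclideanSpace ℝ (Fin k₂)) := by
  obtain ⟨L, hL, hdense⟩ := h
  have hx : L (fun _ => x) = 0 := limit_const_eq_zero h𝒰 hL hdense
  let i₁ : (ℝ → X₁) → ℝ → WithLp 2 (X₁ × X₂) := fun y ε => WithLp.toLp 2 (y ε, x.snd)
  let i₂ : (ℝ → X₂) → ℝ → WithLp 2 (X₁ × X₂) := fun y ε => WithLp.toLp 2 (x.fst, y ε)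
  have hd₁ : ∀ y z : ℝ → X₁, ∀ ε, dist (i₁ y ε) (i₁ z ε) = dist (y ε) (z ε) := fun y z ε => by
    rw [← sq_eq_sq₀ dist_nonneg dist_nonneg, WithLp.prod_dist_sq]
    change dist (y ε) (z ε) ^ 2 + dist x.snd x.snd ^ 2 = _
    simp
  have hd₂ : ∀ y z : ℝ → X₂, ∀ ε, dist (i₂ y ε) (i₂ z ε) = dist (y ε) (z ε) := fun y z ε => by
    rw [← sq_eq_sq₀ dist_nonneg dist_nonneg, WithLp.prod_dist_sq]
    change dist x.fst x.fst ^ 2 + dist (y ε) (z ε) ^ 2 = _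
    simp
  have hi₁ : ∀ y ∈ blowupFamilies x.fst, i₁ y ∈ blowupFamilies x := fun y hy ε hε =>
    (hd₁ y (fun _ => x.fst) ε).trans_le (hy ε hε)
  have hi₂ : ∀ y ∈ blowupFamilies x.snd, i₂ y ∈ blowupFamilies x := fun y hy ε hε =>
    (hd₂ y (fun _ => x.snd) ε).trans_le (hy ε hε)
  have hfst : ∀ y ∈ blowupFamilies x, (fun ε => (y ε).fst) ∈ blowupFamilies x.fst :=
    fun y hy ε hε => (WithLp.dist_fst_le _ _).trans (hy ε hε)
  have hsnd : ∀ y ∈ blowupFamilies x, (fun ε => (y ε).snd) ∈ blowupFamilies x.snd :=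
    fun y hy ε hε => (WithLp.dist_snd_le _ _).trans (hy ε hε)
  have hL₁ : ∀ y ∈ blowupFamilies x.fst, ∀ z ∈ blowupFamilies x.fst,
      Tendsto (fun ε => dist (y ε) (z ε) / ε) 𝒰 (𝓝 (dist (L (i₁ y)) (L (i₁ z)))) :=
    fun y hy z hz => by simpa only [hd₁] using hL _ (hi₁ y hy) _ (hi₁ z hz)
  have hL₂ : ∀ y ∈ blowupFamilies x.snd, ∀ z ∈ blowupFamilies x.snd,
      Tendsto (fun ε => dist (y ε) (z ε) / ε) 𝒰 (𝓝 (dist (L (i₂ y)) (L (i₂ z)))) :=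
    fun y hy z hz => by simpa only [hd₂] using hL _ (hi₂ y hy) _ (hi₂ z hz)
  have hpyth : ∀ p ∈ blowupFamilies x, ∀ q ∈ blowupFamilies x,
      dist (L p) (L q) ^ 2 =
        dist (L (i₁ fun ε => (p ε).fst)) (L (i₁ fun ε => (q ε).fst)) ^ 2 +
        dist (L (i₂ fun ε => (p ε).snd)) (L (i₂ fun ε => (q ε).snd)) ^ 2 := by
    intro p hp q hq
    refine tendsto_nhds_unique ((hL p hp q hq).pow 2)
      ((((hL₁ _ (hfst p hp) _ (hfst q hq)).pow 2).add
        ((hL₂ _ (hsnd p hp) _ (hsnd q hq)).pow 2)).congr fun ε => ?_)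
    rw [div_pow, div_pow, div_pow, ← add_div, ← WithLp.prod_dist_sq]
  have horth : ∀ y ∈ blowupFamilies x.fst, ∀ z ∈ blowupFamilies x.snd,
      inner ℝ (L (i₁ y)) (L (i₂ z)) = 0 := by
    intro y hy z hz
    have h1 : dist (L (i₁ y)) (L (i₂ z)) ^ 2 =
        dist (L (i₁ y)) (L fun _ => x) ^ 2 + dist (L fun _ => x) (L (i₂ z)) ^ 2 :=
      hpyth _ (hi₁ y hy) _ (hi₂ z hz)
    rw [hx, dist_zero_right, dist_zero_left, dist_eq_norm, norm_sub_sq_real] at h1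
    linarith
  have hsum : ∀ p ∈ blowupFamilies x,
      L p = L (i₁ fun ε => (p ε).fst) + L (i₂ fun ε => (p ε).snd) := by
    intro p hp
    have h0 := horth _ (hfst p hp) _ (hsnd p hp)
    have h1 : dist (L p) (L fun _ => x) ^ 2 =
        dist (L (i₁ fun ε => (p ε).fst)) (L fun _ => x) ^ 2 +
        dist (L (i₂ fun ε => (p ε).snd)) (L fun _ => x) ^ 2 :=
      hpyth p hp _ (const_mem_blowupFamilies x)
    have h2 : dist (L p) (L (i₁ fun ε => (p ε).fst)) ^ 2 =
        dist (L (i₁ fun ε => (p ε).fst)) (L (i₁ fun ε => (p ε).fst)) ^ 2 +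
        dist (L (i₂ fun ε => (p ε).snd)) (L fun _ => x) ^ 2 :=
      hpyth p hp _ (hi₁ _ (hfst p hp))
    have h3 : dist (L p) (L (i₂ fun ε => (p ε).snd)) ^ 2 =
        dist (L (i₁ fun ε => (p ε).fst)) (L fun _ => x) ^ 2 +
        dist (L (i₂ fun ε => (p ε).snd)) (L (i₂ fun ε => (p ε).snd)) ^ 2 :=
      hpyth p hp _ (hi₂ _ (hsnd p hp))
    generalize L (i₁ fun ε => (p ε).fst) = a at *
    generalize L (i₂ fun ε => (p ε).snd) = b at *
    generalize L p = f at *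
    rw [hx] at h1 h2 h3
    simp only [dist_zero_right, dist_self] at h1 h2 h3
    rw [dist_eq_norm, norm_sub_sq_real] at h2 h3
    rw [← sub_eq_zero, ← norm_eq_zero, ← sq_eq_zero_iff, norm_sub_sq_real, norm_add_sq_real,
      inner_add_right, h0]
    linarith
  set A := (fun y => L (i₁ y)) '' blowupFamilies x.fst with hA
  set B := (fun y => L (i₂ y)) '' blowupFamilies x.snd with hB
  have hAB : ∀ a ∈ A, ∀ b ∈ B, inner ℝ a b = 0 := by
    rintro _ ⟨y, hy, rfl⟩ _ ⟨z, hz, rfl⟩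
    exact horth y hy z hz
  have hcl : closedBall (0 : E) 1 ⊆ closure (Set.image2 (· + ·) A B) := by
    refine hdense.trans (closure_mono ?_)
    rintro _ ⟨p, hp, rfl⟩
    exact ⟨_, ⟨_, hfst p hp, rfl⟩, _, ⟨_, hsnd p hp, rfl⟩, (hsum p hp).symm⟩
  have hperp : Submodule.span ℝ A ⟂ Submodule.span ℝ B :=
    Submodule.isOrtho_span.2 fun a ha b hb => hAB a ha b hb
  have htop : Submodule.span ℝ A ⊔ Submodule.span ℝ B = ⊤ := by
    have hsub : closedBall (0 : E) 1 ⊆ (Submodule.span ℝ A ⊔ Submodule.span ℝ B : Submodule ℝ E) := by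
      refine hcl.trans (closure_minimal ?_ (Submodule.closed_of_finiteDimensional _))
      rintro _ ⟨a, ha, b, hb, rfl⟩
      exact Submodule.add_mem_sup (Submodule.subset_span ha) (Submodule.subset_span hb)
    refine Submodule.eq_top_of_nonempty_interior' _ ⟨0, ?_⟩
    exact mem_interior_iff_mem_nhds.2
      (Filter.mem_of_superset (closedBall_mem_nhds _ one_pos) hsub)
  refine ⟨_, _, Submodule.finrank_add_eq_of_isCompl
    ⟨hperp.disjoint, codisjoint_iff.2 htop⟩, HasBlowup.euclidean ?_ rfl, HasBlowup.euclidean ?_ rfl⟩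
  · refine HasBlowup.of_mem_submodule _ (fun y => L (i₁ y))
      (fun y hy => Submodule.subset_span ⟨y, hy, rfl⟩) hL₁ fun v hv hv1 => ?_
    exact mem_closure_of_orthogonal_add hAB hv (hcl (by simpa using hv1))
  · refine HasBlowup.of_mem_submodule _ (fun y => L (i₂ y))
      (fun y hy => Submodule.subset_span ⟨y, hy, rfl⟩) hL₂ fun v hv hv1 => ?_
    refine mem_closure_of_orthogonal_add (B := A)
      (fun b hb a ha => by rw [real_inner_comm]; exact hAB a ha b hb) hv ?_
    rw [Set.image2_comm fun a b => add_comm a b]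
    exact hcl (by simpa using hv1)

end Product

section Regular

open GromovHausdorff

lemma exists_approx_of_ghDist_lt {Y Z : Type*} [MetricSpace Y] [CompactSpace Y] [Nonempty Y]
    [MetricSpace Z] [CompactSpace Z] [Nonempty Z] {r : ℝ} (h : ghDist Y Z < r) :
    ∃ φ : Y → Z, (∀ a b, |dist (φ a) (φ b) - dist a b| ≤ 2 * r) ∧
      ∀ v, ∃ a, dist (φ a) v ≤ 2 * r := by
  obtain ⟨Φ, Ψ, hΦ, hΨ, heq⟩ := ghDist_eq_hausdorffDist Y Z
  rw [heq] at h
  have hfin : hausdorffEDist (range Φ) (range Ψ) ≠ ⊤ :=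
    hausdorffEDist_ne_top_of_nonempty_of_bounded (range_nonempty _) (range_nonempty _)
      (isCompact_range hΦ.continuous).isBounded (isCompact_range hΨ.continuous).isBounded
  have hex : ∀ a, ∃ b, dist (Φ a) (Ψ b) < r := fun a => by
    obtain ⟨_, ⟨b, rfl⟩, hb⟩ := exists_dist_lt_of_hausdorffDist_lt (mem_range_self a) h hfin
    exact ⟨b, hb⟩
  choose φ hφ using hex
  refine ⟨φ, fun a b => ?_, fun v => ?_⟩
  · rw [← hΦ.dist_eq a b, ← hΨ.dist_eq (φ a) (φ b), abs_le]
    have ha := hφ a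
    have hb := hφ b
    have h1 := dist_triangle4 (Φ a) (Ψ (φ a)) (Ψ (φ b)) (Φ b)
    have h2 := dist_triangle4 (Ψ (φ a)) (Φ a) (Φ b) (Ψ (φ b))
    rw [dist_comm (Ψ (φ b)) (Φ b)] at h1
    rw [dist_comm (Ψ (φ a)) (Φ a)] at h2
    constructor <;> linarith
  · obtain ⟨_, ⟨a, rfl⟩, ha⟩ := exists_dist_lt_of_hausdorffDist_lt' (mem_range_self v) h hfin
    refine ⟨a, ?_⟩
    rw [← hΨ.dist_eq]
    linarith [hφ a, dist_triangle_left (Ψ (φ a)) (Ψ v) (Φ a)]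

variable {X : Type} [MetricSpace X] [ProperSpace X] {x : X} {n : ℕ}

lemma ghBallRatio_nonneg (ε : ℝ) : 0 ≤ ghBallRatio n x ε := by
  unfold ghBallRatio
  split_ifs with h
  · exact div_nonneg dist_nonneg h.le
  · exact le_rfl

lemma exists_approx_of_ghBallRatio_lt {ε r : ℝ} (hε : 0 < ε) (h : ghBallRatio n x ε < r) :
    ∃ φ : X → EuclideanSpace ℝ (Fin n), (∀ y ∈ closedBall x ε, φ y ∈ closedBall 0 ε) ∧
      (∀ y ∈ closedBall x ε, ∀ z ∈ closedBall x ε,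
        |dist (φ y) (φ z) - dist y z| ≤ 2 * (r * ε)) ∧
      ∀ v ∈ closedBall (0 : EuclideanSpace ℝ (Fin n)) ε, ∃ y ∈ closedBall x ε,
        dist (φ y) v ≤ 2 * (r * ε) := by
  classical
  rw [ghBallRatio, dif_pos hε, div_lt_iff₀ hε] at h
  have : Nonempty (closedBall x ε) := ⟨⟨x, mem_closedBall_self hε.le⟩⟩
  have : Nonempty (closedBall (0 : EuclideanSpace ℝ (Fin n)) ε) :=
    ⟨⟨0, mem_closedBall_self hε.le⟩⟩
  obtain ⟨φ, hφ, hsurj⟩ := exists_approx_of_ghDist_lt h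
  refine ⟨fun y => if hy : y ∈ closedBall x ε then φ ⟨y, hy⟩ else 0, fun y hy => ?_,
    fun y hy z hz => ?_, fun v hv => ?_⟩
  · simp only [dif_pos hy]
    exact (φ ⟨y, hy⟩).2
  · simp only [dif_pos hy, dif_pos hz]
    exact hφ ⟨y, hy⟩ ⟨z, hz⟩
  · obtain ⟨⟨y, hy⟩, h⟩ := hsurj ⟨v, hv⟩
    refine ⟨y, hy, ?_⟩
    simp only [dif_pos hy]
    exact h

lemma dist_inv_smul_smul {E : Type*} [NormedAddCommGroup E] [NormedSpace ℝ E] {ε : ℝ}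
    (hε : 0 < ε) (v w : E) : dist (ε⁻¹ • v) (ε⁻¹ • w) = dist v w / ε := by
  rw [dist_smul₀, norm_inv, Real.norm_of_nonneg hε.le, inv_mul_eq_div]

lemma IsRegularPoint.hasBlowup (h : IsRegularPoint n x) (h𝒰 : (𝒰 : Filter ℝ) ≤ 𝓝[>] 0) :
    HasBlowup 𝒰 x (EuclideanSpace ℝ (Fin n)) := by
  have hpos : ∀ᶠ ε in (𝒰 : Filter ℝ), 0 < ε := h𝒰 self_mem_nhdsWithin
  set r : ℝ → ℝ := fun ε => ghBallRatio n x ε + ε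
  have hr : Tendsto (fun ε => 2 * r ε) 𝒰 (𝓝 0) := by
    have h1 : Tendsto (ghBallRatio n x) 𝒰 (𝓝 0) := Tendsto.mono_left h h𝒰
    have h2 : Tendsto (fun ε : ℝ => ε) 𝒰 (𝓝 0) := h𝒰.trans nhdsWithin_le_nhds
    simpa using (h1.add h2).const_mul 2
  have hex : ∀ ε : ℝ, ∃ φ : X → EuclideanSpace ℝ (Fin n), 0 < ε →
      (∀ y ∈ closedBall x ε, φ y ∈ closedBall 0 ε) ∧
      (∀ y ∈ closedBall x ε, ∀ z ∈ closedBall x ε,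
        |dist (φ y) (φ z) - dist y z| ≤ 2 * (r ε * ε)) ∧
      ∀ v ∈ closedBall (0 : EuclideanSpace ℝ (Fin n)) ε, ∃ y ∈ closedBall x ε,
        dist (φ y) v ≤ 2 * (r ε * ε) := fun ε => by
    by_cases hε : 0 < ε
    · obtain ⟨φ, hφ⟩ := exists_approx_of_ghBallRatio_lt (n := n) (x := x) hε (lt_add_of_pos_right _ hε)
      exact ⟨φ, fun _ => hφ⟩
    · exact ⟨0, fun h => absurd h hε⟩
  choose φ hφ using hex
  have hlim : ∀ y : ℝ → X, ∃ a : EuclideanSpace ℝ (Fin n), y ∈ blowupFamilies x →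
      Tendsto (fun ε => ε⁻¹ • φ ε (y ε)) 𝒰 (𝓝 a) := fun y => by
    by_cases hy : y ∈ blowupFamilies x
    · obtain ⟨a, -, ha⟩ := (isCompact_closedBall (0 : EuclideanSpace ℝ (Fin n)) 1).ultrafilter_le_nhds
        (𝒰.map fun ε => ε⁻¹ • φ ε (y ε)) (by
          rw [le_principal_iff]
          change ∀ᶠ ε in (𝒰 : Filter ℝ), ε⁻¹ • φ ε (y ε) ∈ closedBall 0 1
          filter_upwards [hpos] with ε hε
          have h1 := (hφ ε hε).1 (y ε) (hy ε hε)
          rw [mem_closedBall] at h1 ⊢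
          rw [← smul_zero ε⁻¹, dist_inv_smul_smul hε]
          exact (div_le_one hε).2 h1)
      exact ⟨a, fun _ => ha⟩
    · exact ⟨0, fun h => absurd h hy⟩
  choose L hL using hlim
  refine ⟨L, fun y hy z hz => ?_, fun v hv => subset_closure ?_⟩
  · have hdiff : Tendsto (fun ε => dist (ε⁻¹ • φ ε (y ε)) (ε⁻¹ • φ ε (z ε)) -
        dist (y ε) (z ε) / ε) 𝒰 (𝓝 0) := by
      refine squeeze_zero_norm' ?_ hr
      filter_upwards [hpos] with ε hε
      rw [dist_inv_smul_smul hε, ← sub_div, Real.norm_eq_abs, abs_div, abs_of_pos hε,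
        div_le_iff₀ hε, mul_assoc]
      exact (hφ ε hε).2.1 _ (hy ε hε) _ (hz ε hε)
    simpa using ((hL y hy).dist (hL z hz)).sub hdiff
  · have hex : ∀ ε : ℝ, ∃ y : X, 0 < ε → y ∈ closedBall x ε ∧
        dist (φ ε y) (ε • v) ≤ 2 * (r ε * ε) := fun ε => by
      by_cases hε : 0 < ε
      · obtain ⟨y, hy⟩ := (hφ ε hε).2.2 (ε • v) (by
          rw [mem_closedBall_zero_iff] at hv ⊢
          rw [norm_smul, Real.norm_of_nonneg hε.le]
          exact mul_le_of_le_one_right hε.le hv)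
        exact ⟨y, fun _ => hy⟩
      · exact ⟨x, fun h => absurd h hε⟩
    choose y hy using hex
    have hyx : y ∈ blowupFamilies x := fun ε hε => (hy ε hε).1
    refine ⟨y, hyx, tendsto_nhds_unique (hL y hyx) ?_⟩
    rw [tendsto_iff_dist_tendsto_zero]
    refine squeeze_zero' (Eventually.of_forall fun _ => dist_nonneg) ?_ hr
    filter_upwards [hpos] with ε hε
    have h1 := (hy ε hε).2
    rw [← mul_assoc, ← div_le_iff₀ hε, ← dist_inv_smul_smul hε, inv_smul_smul₀ hε.ne'] at h1
    exact h1

lemma ghBallRatio_le_of_net {ε δ : ℝ} (hε : 0 < ε) {T : Set (EuclideanSpace ℝ (Fin n))}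
    {f : EuclideanSpace ℝ (Fin n) → X} (hT : ∀ w ∈ T, ‖w‖ ≤ 1)
    (hf : ∀ w ∈ T, f w ∈ closedBall x ε)
    (hnet : ∀ v ∈ closedBall (0 : EuclideanSpace ℝ (Fin n)) 1, ∃ w ∈ T, dist v w ≤ δ)
    (hfnet : ∀ z ∈ closedBall x ε, ∃ w ∈ T, dist z (f w) ≤ 2 * δ * ε)
    (hdist : ∀ w ∈ T, ∀ w' ∈ T, |dist w w' - dist (f w) (f w') / ε| ≤ δ) :
    ghBallRatio n x ε ≤ 4 * δ := by
  have hδ : 0 ≤ δ := by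
    obtain ⟨w, -, hw⟩ := hnet 0 (mem_closedBall_self zero_le_one)
    exact dist_nonneg.trans hw
  have : Nonempty (closedBall x ε) := ⟨⟨x, mem_closedBall_self hε.le⟩⟩
  have : Nonempty (closedBall (0 : EuclideanSpace ℝ (Fin n)) ε) :=
    ⟨⟨0, mem_closedBall_self hε.le⟩⟩
  have hsmul : ∀ w ∈ T, ε • w ∈ closedBall (0 : EuclideanSpace ℝ (Fin n)) ε := fun w hw => by
    rw [mem_closedBall_zero_iff, norm_smul, Real.norm_of_nonneg hε.le]
    exact mul_le_of_le_one_right hε.le (hT w hw)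
  let s : Set (closedBall (0 : EuclideanSpace ℝ (Fin n)) ε) := {u | ε⁻¹ • u.1 ∈ T}
  have hmem : ∀ w (hw : w ∈ T), (⟨ε • w, hsmul w hw⟩ : closedBall _ ε) ∈ s := fun w hw => by
    change ε⁻¹ • ε • w ∈ T
    rwa [inv_smul_smul₀ hε.ne']
  have key : ghDist (closedBall (0 : EuclideanSpace ℝ (Fin n)) ε) (closedBall x ε) ≤
      δ * ε + δ * ε / 2 + 2 * δ * ε := by
    refine ghDist_le_of_approx_subsets (s := s) (fun u => ⟨f (ε⁻¹ • u.1.1), hf _ u.2⟩) ?_ ?_ ?_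
    · rintro ⟨u, hu⟩
      obtain ⟨w, hw, huw⟩ := hnet (ε⁻¹ • u) (by
        rw [mem_closedBall] at hu ⊢
        rw [← smul_zero ε⁻¹, dist_inv_smul_smul hε]
        exact (div_le_one hε).2 hu)
      refine ⟨⟨ε • w, hsmul w hw⟩, hmem w hw, ?_⟩
      rw [← inv_smul_smul₀ hε.ne' w, dist_inv_smul_smul hε, div_le_iff₀ hε] at huw
      exact huw
    · rintro ⟨z, hz⟩
      obtain ⟨w, hw, hzw⟩ := hfnet z hz
      refine ⟨⟨⟨ε • w, hsmul w hw⟩, hmem w hw⟩, ?_⟩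
      rw [Subtype.dist_eq]
      simpa only [inv_smul_smul₀ hε.ne'] using hzw
    · rintro ⟨⟨u, hu⟩, hus⟩ ⟨⟨v, hv⟩, hvs⟩
      have h := hdist _ hus _ hvs
      rw [dist_inv_smul_smul hε, ← sub_div, abs_div, abs_of_pos hε, div_le_iff₀ hε] at h
      exact h
  rw [ghBallRatio, dif_pos hε, div_le_iff₀ hε]
  refine (dist_comm _ _).trans_le (key.trans ?_)
  nlinarith [mul_nonneg hδ hε.le]

lemma HasBlowup.tendsto_ghBallRatio (h𝒰 : (𝒰 : Filter ℝ) ≤ 𝓝[>] 0)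
    (h : HasBlowup 𝒰 x (EuclideanSpace ℝ (Fin n))) : Tendsto (ghBallRatio n x) 𝒰 (𝓝 0) := by
  obtain ⟨L, hL, hdense⟩ := h
  have hpos : ∀ᶠ ε in (𝒰 : Filter ℝ), 0 < ε := h𝒰 self_mem_nhdsWithin
  have hL1 : ∀ y ∈ blowupFamilies x, ‖L y‖ ≤ 1 := fun y hy => by
    have := dist_limit_const_le_one h𝒰 hL hy
    rwa [limit_const_eq_zero h𝒰 hL hdense, dist_zero_right] at this
  rw [Metric.tendsto_nhds]
  intro η hη
  obtain ⟨δ, hδ, hδη⟩ : ∃ δ > 0, 4 * δ < η := ⟨η / 5, by positivity, by linarith⟩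
  obtain ⟨T, hTL, hTfin, hTcov⟩ :=
    (isCompact_closedBall (0 : EuclideanSpace ℝ (Fin n)) 1).elim_finite_subcover_image
      (b := L '' blowupFamilies x) (c := fun w => ball w δ) (fun _ _ => isOpen_ball) fun v hv => by
        obtain ⟨w, hw, hvw⟩ := Metric.mem_closure_iff.1 (hdense hv) δ hδ
        exact mem_iUnion₂.2 ⟨w, hw, hvw⟩
  have hnet : ∀ v ∈ closedBall (0 : EuclideanSpace ℝ (Fin n)) 1, ∃ w ∈ T, dist v w < δ :=
    fun v hv => by
      obtain ⟨w, hw, hvw⟩ := mem_iUnion₂.1 (hTcov hv)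
      exact ⟨w, hw, hvw⟩
  have hex : ∀ w, ∃ y : ℝ → X, w ∈ T → y ∈ blowupFamilies x ∧ L y = w := fun w => by
    by_cases hw : w ∈ T
    · obtain ⟨y, hy, hyw⟩ := hTL hw
      exact ⟨y, fun _ => ⟨hy, hyw⟩⟩
    · exact ⟨fun _ => x, fun h => absurd h hw⟩
  choose Y hY using hex
  have hdist : ∀ᶠ ε in (𝒰 : Filter ℝ), ∀ w ∈ T, ∀ w' ∈ T,
      |dist w w' - dist (Y w ε) (Y w' ε) / ε| ≤ δ := by
    refine (eventually_all_finite hTfin).2 fun w hw => (eventually_all_finite hTfin).2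
      fun w' hw' => ?_
    have hlim := hL _ (hY w hw).1 _ (hY w' hw').1
    rw [(hY w hw).2, (hY w' hw').2] at hlim
    filter_upwards [Metric.tendsto_nhds.1 hlim δ hδ] with ε hε
    rw [dist_comm, Real.dist_eq] at hε
    exact hε.le
  have hfnet : ∀ᶠ ε in (𝒰 : Filter ℝ), ∀ z ∈ closedBall x ε, ∃ w ∈ T,
      dist z (Y w ε) ≤ 2 * δ * ε := by
    by_contra hcon
    rw [← Ultrafilter.eventually_not] at hcon
    have hex : ∀ ε : ℝ, ∃ z : X, (0 < ε → z ∈ closedBall x ε) ∧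
        ((¬ ∀ z ∈ closedBall x ε, ∃ w ∈ T, dist z (Y w ε) ≤ 2 * δ * ε) →
          ∀ w ∈ T, 2 * δ * ε < dist z (Y w ε)) := fun ε => by
      by_cases hε : ∀ z ∈ closedBall x ε, ∃ w ∈ T, dist z (Y w ε) ≤ 2 * δ * ε
      · exact ⟨x, fun h => mem_closedBall_self h.le, fun h => absurd hε h⟩
      · push Not at hε
        obtain ⟨z, hz, hzw⟩ := hε
        exact ⟨z, fun _ => hz, fun _ => hzw⟩
    choose z hz using hex
    have hzx : z ∈ blowupFamilies x := fun ε hε => (hz ε).1 hε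
    obtain ⟨w, hw, hzw⟩ := hnet (L z) (mem_closedBall_zero_iff.2 (hL1 z hzx))
    have hlim := hL z hzx _ (hY w hw).1
    rw [(hY w hw).2] at hlim
    have hge : 2 * δ ≤ dist (L z) w := by
      refine ge_of_tendsto hlim ?_
      filter_upwards [hcon, hpos] with ε h1 h2
      exact (le_div_iff₀ h2).2 ((hz ε).2 h1 w hw).le
    linarith
  filter_upwards [hpos, hdist, hfnet] with ε hε h1 h2
  rw [Real.dist_eq, sub_zero, abs_of_nonneg (ghBallRatio_nonneg ε)]
  refine (ghBallRatio_le_of_net hε (f := fun w => Y w ε) (fun w hw => ?_)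
    (fun w hw => (hY w hw).1 ε hε) (fun v hv => ?_) h2 h1).trans_lt hδη
  · rw [← (hY w hw).2]
    exact hL1 _ (hY w hw).1
  · obtain ⟨w, hw, hvw⟩ := hnet v hv
    exact ⟨w, hw, hvw.le⟩

/-- Regular points are those at which every blow-up is Euclidean. -/
lemma isRegularPoint_iff_hasBlowup :
    IsRegularPoint n x ↔ ∀ 𝒰 : Ultrafilter ℝ, (𝒰 : Filter ℝ) ≤ 𝓝[>] 0 →
      HasBlowup 𝒰 x (EuclideanSpace ℝ (Fin n)) :=
  ⟨fun h _ h𝒰 => h.hasBlowup h𝒰, fun h => (tendsto_iff_ultrafilter _ _ _).2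
    fun 𝒰 h𝒰 => (h 𝒰 h𝒰).tendsto_ghBallRatio h𝒰⟩

end Regular

end Blowup

/-- for Alexandrov spaces `X₁, X₂` (of curvature `≥ K`, with Hausdorff
dimensions `n₁, n₂`), the regular set of the product `X₁ × X₂` (with the ℓ²-product
metric) is the product of the regular sets, and consequently the singular set of
`X₁ × X₂` is `(X₁ × X₂^sing) ∪ (X₁^sing × X₂)`. -/
theorem regular_points_of_product (X₁ X₂ : Type)
    [MetricSpace X₁] [MetricSpace X₂] [ProperSpace X₁] [ProperSpace X₂]
    [CompleteSpace X₁] [CompleteSpace X₂] [ProperSpace (WithLp 2 (X₁ × X₂))]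
    (geo₁ : ∀ x y : X₁, Nonempty (GeodesicIn X₁ x y))
    (geo₂ : ∀ x y : X₂, Nonempty (GeodesicIn X₂ x y))
    (K : ℝ) (hK₁ : AlexandrovCurvGE K X₁) (hK₂ : AlexandrovCurvGE K X₂)
    (n₁ n₂ : ℕ) (hn₁ : dimH (Set.univ : Set X₁) = n₁) (hn₂ : dimH (Set.univ : Set X₂) = n₂) :
    ({p : WithLp 2 (X₁ × X₂) | IsRegularPoint (n₁ + n₂) p}
        = {p : WithLp 2 (X₁ × X₂) |
            IsRegularPoint n₁ ((WithLp.equiv 2 (X₁ × X₂)) p).1 ∧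
            IsRegularPoint n₂ ((WithLp.equiv 2 (X₁ × X₂)) p).2}) ∧
    ({p : WithLp 2 (X₁ × X₂) | ¬ IsRegularPoint (n₁ + n₂) p}
        = {p : WithLp 2 (X₁ × X₂) | ¬ IsRegularPoint n₁ ((WithLp.equiv 2 (X₁ × X₂)) p).1}
          ∪ {p : WithLp 2 (X₁ × X₂) |
              ¬ IsRegularPoint n₂ ((WithLp.equiv 2 (X₁ × X₂)) p).2}) := by
  have hprod : {p : WithLp 2 (X₁ × X₂) | IsRegularPoint (n₁ + n₂) p}
      = {p : WithLp 2 (X₁ × X₂) |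
          IsRegularPoint n₁ ((WithLp.equiv 2 (X₁ × X₂)) p).1 ∧
          IsRegularPoint n₂ ((WithLp.equiv 2 (X₁ × X₂)) p).2} := by
    ext p
    change IsRegularPoint (n₁ + n₂) p ↔ IsRegularPoint n₁ p.fst ∧ IsRegularPoint n₂ p.snd
    simp only [isRegularPoint_iff_hasBlowup]
    refine ⟨fun h => ?_, fun h 𝒰 h𝒰 => ?_⟩
    · have key : ∀ 𝒰 : Ultrafilter ℝ, (𝒰 : Filter ℝ) ≤ nhdsWithin 0 (Set.Ioi 0) →
          HasBlowup 𝒰 p.fst (EuclideanSpace ℝ (Fin n₁)) ∧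
          HasBlowup 𝒰 p.snd (EuclideanSpace ℝ (Fin n₂)) := fun 𝒰 h𝒰 => by
        obtain ⟨k₁, k₂, hk, h₁, h₂⟩ := (h 𝒰 h𝒰).exists_split h𝒰
        have hle₁ : n₁ ≤ k₁ := by
          have := hK₁.dimH_le_of_hasBlowup geo₁ h𝒰 h₁
          rw [hn₁] at this
          exact_mod_cast this
        have hle₂ : n₂ ≤ k₂ := by
          have := hK₂.dimH_le_of_hasBlowup geo₂ h𝒰 h₂
          rw [hn₂] at this
          exact_mod_cast this
        rw [finrank_euclideanSpace_fin] at hk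
        obtain rfl : k₁ = n₁ := by omega
        obtain rfl : k₂ = n₂ := by omega
        exact ⟨h₁, h₂⟩
      exact ⟨fun 𝒰 h𝒰 => (key 𝒰 h𝒰).1, fun 𝒰 h𝒰 => (key 𝒰 h𝒰).2⟩
    · refine ((h.1 𝒰 h𝒰).prod h𝒰 (h.2 𝒰 h𝒰)).euclidean ?_
      rw [(WithLp.linearEquiv 2 ℝ _).finrank_eq, Module.finrank_prod,
        finrank_euclideanSpace_fin, finrank_euclideanSpace_fin]
  refine ⟨hprod, ?_⟩
  ext p
  have hp : IsRegularPoint (n₁ + n₂) p ↔ _ := Set.ext_iff.1 hprod p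
  exact (not_congr hp).trans not_and_or
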